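/- arXiv:2003.11722 — 12 statements merged into one kernel-verified Lean document; each statement's English description precedes it below -/
import Mathlib

section
/- Suppose a strategy α admits domain index subsets w_i (for i : Fin m5) satisfying the causal condition, i.e., (A1) H_E j i = 0 whenever j ∈ w_i, and (A2) w_i ⊆ w_{i'} whenever i ≤ i'. Then α satisfies the uniqueness condition: for every x : Fin m3 → F there exists a unique y : Fin m6 → F with y = K_E.mulVec x + H_E.mulVec (α y). -/
/-- A self-map with a constant iterate has a unique fixed point. -/
theorem Function.existsUnique_eq_of_iterate_const {X : Type*} [Nonempty X] (g : X → X) (n : ℕ)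
    (h : ∀ y y' : X, g^[n] y = g^[n] y') : ∃! y, y = g y := by
  obtain ⟨y₀⟩ := ‹Nonempty X›
  refine ⟨g^[n] y₀, ?_, fun y hy => ?_⟩
  · change g^[n] y₀ = g (g^[n] y₀)
    rw [← Function.iterate_succ_apply' g, Function.iterate_succ_apply]
    exact h _ _
  · rw [← Function.iterate_fixed hy.symm n]
    exact h _ _

/-- Under the causal condition, the first `k` components of the strategy evaluated at the `k`-th
iterate of the feedback map do not depend on the starting point. -/
theorem causal_iterate_agree {F : Type*} [Field F] {m n : ℕ}
    (c : Fin m → F) (H : Matrix (Fin m) (Fin n) F) (α : (Fin m → F) → (Fin n → F))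
    (w : Fin n → Set (Fin m))
    (hdom : ∀ (i : Fin n) (y y' : Fin m → F), (∀ j ∈ w i, y j = y' j) → α y i = α y' i)
    (hA1 : ∀ (i : Fin n), ∀ j ∈ w i, H j i = 0)
    (hA2 : ∀ i i' : Fin n, i ≤ i' → w i ⊆ w i') (y y' : Fin m → F) (k : ℕ) :
    ∀ i : Fin n, (i : ℕ) < k →
      α ((fun z => c + H.mulVec (α z))^[k] y) i = α ((fun z => c + H.mulVec (α z))^[k] y') i := by
  induction k with
  | zero => intro i hi; omega
  | succ k ih =>
    intro i hi
    refine hdom i _ _ fun j hj => ?_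
    simp only [Function.iterate_succ_apply', Pi.add_apply, Matrix.mulVec, dotProduct]
    congr 1
    refine Finset.sum_congr rfl fun i' _ => ?_
    rcases le_or_gt i i' with hle | hlt
    · rw [hA1 i' j (hA2 i i' hle hj), zero_mul, zero_mul]
    · rw [ih i' (by have : (i' : ℕ) < i := hlt; omega)]

/-- **Causal condition implies the uniqueness condition (single transmission).**
In the wiretap and addition model given by `K_E` and `H_E`, if the strategy `α`
admits domain index subsets `w i` (i.e. `α i` depends only on the coordinates in `w i`)
satisfying the causal condition (A1) `H_E j i = 0` for `j ∈ w i` and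
(A2) `w i ⊆ w i'` for `i ≤ i'`, then for every input `x` there is a unique
observation `y` with `y = K_E.mulVec x + H_E.mulVec (α y)`. -/
theorem causal_implies_uniqueness
    {F : Type*} [Field F] [Fintype F] {m3 m5 m6 : ℕ}
    (K_E : Matrix (Fin m6) (Fin m3) F) (H_E : Matrix (Fin m6) (Fin m5) F)
    (α : (Fin m6 → F) → (Fin m5 → F))
    (w : Fin m5 → Set (Fin m6))
    (hdom : ∀ (i : Fin m5) (y y' : Fin m6 → F),
      (∀ j ∈ w i, y j = y' j) → α y i = α y' i)
    (hA1 : ∀ (i : Fin m5), ∀ j ∈ w i, H_E j i = 0)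
    (hA2 : ∀ i i' : Fin m5, i ≤ i' → w i ⊆ w i') :
    ∀ x : Fin m3 → F, ∃! y : Fin m6 → F,
      y = K_E.mulVec x + H_E.mulVec (α y) := by
  intro x
  refine Function.existsUnique_eq_of_iterate_const
    (fun z => K_E.mulVec x + H_E.mulVec (α z)) (m5 + 1) fun y y' => ?_
  have h := causal_iterate_agree (K_E.mulVec x) H_E α w hdom hA1 hA2 y y' m5
  simp only [Function.iterate_succ_apply']
  rw [funext fun i => h i i.isLt]
end

section
/- (Reduction Theorem, single transmission, deterministic form.) Suppose the strategy α satisfies the uniqueness condition, and for each x : Fin m3 → F let Y(x) denote the unique solution y of y = K_E.mulVec x + H_E.mulVec (α y). Then there exist functions f, g : (Fin m6 → F) → (Fin m6 → F) such that for every x : Fin m3 → F, Y(x) = f (K_E.mulVec x) and K_E.mulVec x = g (Y(x)). In particular, Eve's observation under the active attack α is computable from her observation K_E.mulVec x under the passive attack (strategy 0), and conversely. -/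
/-- **Reduction theorem (single transmission, deterministic form).**
Suppose the strategy `α` satisfies the uniqueness condition, and `Y x` denotes the
unique solution of `y = K_E.mulVec x + H_E.mulVec (α y)`. Then Eve's observation under
the active attack is a function of her observation `K_E.mulVec x` under the passive
attack, and conversely. -/
theorem reduction_deterministic_single
    {F : Type*} [Field F] [Fintype F] {m3 m5 m6 : ℕ}
    (K_E : Matrix (Fin m6) (Fin m3) F) (H_E : Matrix (Fin m6) (Fin m5) F)
    (α : (Fin m6 → F) → (Fin m5 → F))
    (huniq : ∀ x : Fin m3 → F, ∃! y : Fin m6 → F,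
      y = K_E.mulVec x + H_E.mulVec (α y))
    (Y : (Fin m3 → F) → (Fin m6 → F))
    (hY : ∀ x : Fin m3 → F, Y x = K_E.mulVec x + H_E.mulVec (α (Y x))) :
    ∃ f g : (Fin m6 → F) → (Fin m6 → F),
      (∀ x : Fin m3 → F, Y x = f (K_E.mulVec x)) ∧
      (∀ x : Fin m3 → F, K_E.mulVec x = g (Y x)) := by
  have hfac : Function.FactorsThrough Y K_E.mulVec := fun a b hab =>
    (huniq b).unique (by simpa only [hab] using hY a) (hY b)
  obtain ⟨f, hf⟩ := (Function.factorsThrough_iff Y).mp hfac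
  exact ⟨f, fun y => y - H_E.mulVec (α y), congrFun hf, fun x => eq_sub_of_add_eq (hY x).symm⟩
end

section
/- (Reduction Theorem, single transmission, information form.) Suppose the strategy α satisfies the uniqueness condition, and for each x : Fin m3 → F let Y(x) denote the unique solution y of y = K_E.mulVec x + H_E.mulVec (α y). Then for every measurable space Ω and every map X : Ω → (Fin m3 → F), the σ-algebra generated by the active observation equals the σ-algebra generated by the passive observation: MeasurableSpace.comap (fun ω => Y (X ω)) ⊤ = MeasurableSpace.comap (fun ω => K_E.mulVec (X ω)) ⊤, where ⊤ denotes the discrete σ-algebra on the finite type Fin m6 → F. -/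
theorem MeasurableSpace.comap_top_le_comap_top_of_factorsThrough {Ω β γ : Type*}
    {f : Ω → β} {g : Ω → γ} (h : Function.FactorsThrough f g) :
    MeasurableSpace.comap f ⊤ ≤ MeasurableSpace.comap g ⊤ := by
  rintro _ ⟨s, -, rfl⟩
  refine ⟨g '' (f ⁻¹' s), trivial, ?_⟩
  ext ω
  constructor
  · rintro ⟨ω', hω', hg⟩
    have hf : f ω' = f ω := h hg
    simpa [← hf] using hω'
  · exact fun hω => ⟨ω, hω, rfl⟩

/-- **Reduction theorem (single transmission, information form).**
If the strategy `α` satisfies the uniqueness condition and `Y x` is the unique solution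
of `y = K_E.mulVec x + H_E.mulVec (α y)`, then for any random input `X : Ω → (Fin m3 → F)`
the σ-algebra generated by the active observation `Y (X ω)` equals the σ-algebra generated
by the passive observation `K_E.mulVec (X ω)` (with the discrete σ-algebra `⊤` on the
finite type `Fin m6 → F`). Hence the leaked information coincides for both attacks. -/
theorem reduction_information_single
    {F : Type*} [Field F] [Fintype F] {m3 m5 m6 : ℕ}
    (K_E : Matrix (Fin m6) (Fin m3) F) (H_E : Matrix (Fin m6) (Fin m5) F)
    (α : (Fin m6 → F) → (Fin m5 → F))
    (huniq : ∀ x : Fin m3 → F, ∃! y : Fin m6 → F,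
      y = K_E.mulVec x + H_E.mulVec (α y))
    (Y : (Fin m3 → F) → (Fin m6 → F))
    (hY : ∀ x : Fin m3 → F, Y x = K_E.mulVec x + H_E.mulVec (α (Y x)))
    (Ω : Type*) [MeasurableSpace Ω] (X : Ω → (Fin m3 → F)) :
    MeasurableSpace.comap (fun ω => Y (X ω)) (⊤ : MeasurableSpace (Fin m6 → F)) =
      MeasurableSpace.comap (fun ω => K_E.mulVec (X ω)) (⊤ : MeasurableSpace (Fin m6 → F)) := by
  apply le_antisymm <;>
    refine MeasurableSpace.comap_top_le_comap_top_of_factorsThrough fun a b hab => ?_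
  · have hab : K_E.mulVec (X a) = K_E.mulVec (X b) := hab
    exact (huniq (X a)).unique (hY (X a)) (hab ▸ hY (X b))
  · have hab : Y (X a) = Y (X b) := hab
    have h := (hY (X a)).symm.trans (hab.trans (hY (X b)))
    rw [hab] at h
    exact add_right_cancel h
end

section
/- (Reduction Theorem, multiple transmission, deterministic form.) Suppose the strategy α satisfies the n-uniqueness condition, and for each X : Matrix (Fin m3) (Fin n) F let Y(X) denote the unique solution Y of Y = K_E * X + H_E * (α Y). Then there exist functions f, g : Matrix (Fin m6) (Fin n) F → Matrix (Fin m6) (Fin n) F such that for every X, Y(X) = f (K_E * X) and K_E * X = g (Y(X)). In particular, Eve's observation under the active attack α is computable from her observation K_E * X under the passive attack (strategy 0), and conversely. -/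
/-- **Reduction theorem (multiple transmission, deterministic form).**
In the `n`-transmission wiretap and addition model, if the strategy `α` satisfies the
`n`-uniqueness condition and `Y X` denotes the unique solution of
`Y = K_E * X + H_E * (α Y)`, then Eve's observation under the active attack is a
function of her passive observation `K_E * X`, and conversely. -/
theorem reduction_deterministic_multiple
    {F : Type*} [Field F] [Fintype F] {m3 m5 m6 n : ℕ}
    (K_E : Matrix (Fin m6) (Fin m3) F) (H_E : Matrix (Fin m6) (Fin m5) F)
    (α : Matrix (Fin m6) (Fin n) F → Matrix (Fin m5) (Fin n) F)
    (huniq : ∀ X : Matrix (Fin m3) (Fin n) F, ∃! Y : Matrix (Fin m6) (Fin n) F,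
      Y = K_E * X + H_E * (α Y))
    (Y : Matrix (Fin m3) (Fin n) F → Matrix (Fin m6) (Fin n) F)
    (hY : ∀ X : Matrix (Fin m3) (Fin n) F, Y X = K_E * X + H_E * (α (Y X))) :
    ∃ f g : Matrix (Fin m6) (Fin n) F → Matrix (Fin m6) (Fin n) F,
      (∀ X : Matrix (Fin m3) (Fin n) F, Y X = f (K_E * X)) ∧
      (∀ X : Matrix (Fin m3) (Fin n) F, K_E * X = g (Y X)) := by
  have hfac : Function.FactorsThrough Y (fun X ↦ K_E * X) := fun X₁ X₂ h ↦
    (huniq X₁).unique (hY X₁) ((hY X₂).trans (congrArg (· + H_E * α (Y X₂)) h.symm))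
  exact ⟨Function.extend (fun X ↦ K_E * X) Y 0, fun y ↦ y - H_E * α y,
    fun X ↦ (hfac.extend_apply 0 X).symm, fun X ↦ eq_sub_of_add_eq (hY X).symm⟩
end

section
/- (Reduction Theorem, multiple transmission, information form.) Suppose the strategy α satisfies the n-uniqueness condition, and for each X : Matrix (Fin m3) (Fin n) F let Y(X) denote the unique solution Y of Y = K_E * X + H_E * (α Y). Then for every measurable space Ω and every map X : Ω → Matrix (Fin m3) (Fin n) F, the σ-algebra generated by the active observation equals the σ-algebra generated by the passive observation: MeasurableSpace.comap (fun ω => Y (X ω)) ⊤ = MeasurableSpace.comap (fun ω => K_E * (X ω)) ⊤, where ⊤ denotes the discrete σ-algebra on the finite type Matrix (Fin m6) (Fin n) F. -/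
theorem MeasurableSpace.comap_top_le_comap_top {Ω β γ : Type*} {f : Ω → β} {g : Ω → γ}
    (h : ∀ a b, g a = g b → f a = f b) :
    MeasurableSpace.comap f ⊤ ≤ MeasurableSpace.comap g ⊤ := by
  rintro _ ⟨t, -, rfl⟩
  refine ⟨g '' (f ⁻¹' t), trivial, Set.Subset.antisymm ?_ (Set.subset_preimage_image _ _)⟩
  rintro a ⟨b, hb, hba⟩
  rwa [Set.mem_preimage, ← h b a hba]

/-- **Reduction theorem (multiple transmission, information form).**
In the `n`-transmission wiretap and addition model, if the strategy `α` satisfies the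
`n`-uniqueness condition and `Y X` is the unique solution of `Y = K_E * X + H_E * (α Y)`,
then for any random input `X : Ω → Matrix (Fin m3) (Fin n) F` the σ-algebra generated by
the active observation equals the σ-algebra generated by the passive observation
(with the discrete σ-algebra `⊤` on the finite type `Matrix (Fin m6) (Fin n) F`). -/
theorem reduction_information_multiple
    {F : Type*} [Field F] [Fintype F] {m3 m5 m6 n : ℕ}
    (K_E : Matrix (Fin m6) (Fin m3) F) (H_E : Matrix (Fin m6) (Fin m5) F)
    (α : Matrix (Fin m6) (Fin n) F → Matrix (Fin m5) (Fin n) F)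
    (huniq : ∀ X : Matrix (Fin m3) (Fin n) F, ∃! Y : Matrix (Fin m6) (Fin n) F,
      Y = K_E * X + H_E * (α Y))
    (Y : Matrix (Fin m3) (Fin n) F → Matrix (Fin m6) (Fin n) F)
    (hY : ∀ X : Matrix (Fin m3) (Fin n) F, Y X = K_E * X + H_E * (α (Y X)))
    (Ω : Type*) [MeasurableSpace Ω] (X : Ω → Matrix (Fin m3) (Fin n) F) :
    MeasurableSpace.comap (fun ω => Y (X ω)) (⊤ : MeasurableSpace (Matrix (Fin m6) (Fin n) F)) =
      MeasurableSpace.comap (fun ω => K_E * (X ω)) (⊤ : MeasurableSpace (Matrix (Fin m6) (Fin n) F)) := by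
  apply le_antisymm
  · refine MeasurableSpace.comap_top_le_comap_top fun a b hab => ?_
    refine (huniq (X a)).unique (hY (X a)) ?_
    have hb := hY (X b)
    rwa [← hab] at hb
  · refine MeasurableSpace.comap_top_le_comap_top fun a b hab => ?_
    have ha := hY (X a)
    rw [show Y (X a) = Y (X b) from hab] at ha
    exact add_right_cancel (ha.symm.trans (hY (X b)))
end

section
/- (n-sequential transmission: n-causal condition implies n-uniqueness.) Suppose the strategy α has components α_{i,l} (the (i,l) entry of α Y), admitting domain index subsets w_{i,l} ⊆ Fin m6 × Fin n (i.e., α_{i,l} Y = α_{i,l} Y' whenever Y and Y' agree on all positions in w_{i,l}), and suppose there is an injective time-order function T : Fin m5 × Fin n → ℕ such that: (A1') for all i, l, j, if (j, l) ∈ w_{i,l} then H_E j i = 0; and (A2') w_{i,l} ⊆ w_{i',l'} whenever T(i,l) ≤ T(i',l'). Then α satisfies the n-uniqueness condition: for every X there is a unique Y with Y = K_E * X + H_E * (α Y). -/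
/-- If some iterate of `f` is constant, then `f` has a unique fixed point. -/
theorem existsUnique_eq_apply_of_iterate_const {β : Type*} [Nonempty β] (f : β → β) (k : ℕ)
    (h : ∀ x y, f^[k] x = f^[k] y) : ∃! x, x = f x := by
  obtain ⟨a⟩ := ‹Nonempty β›
  refine ⟨f^[k] a, ?_, fun y hy => ?_⟩
  · change f^[k] a = f (f^[k] a)
    rw [← Function.iterate_succ_apply' f k a, Function.iterate_succ_apply]
    exact h _ _
  · rw [← Function.iterate_fixed hy.symm k]
    exact h _ _


/-- **`n`-sequential transmission: the `n`-causal condition implies the `n`-uniqueness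
condition.** The strategy `α` has components `(α Y) i l`, depending only on the entries of
`Y` at positions in the domain index subset `w i l ⊆ Fin m6 × Fin n`. If there is an
injective time-order function `T` on the injections such that
(A1') `H_E j i = 0` whenever `(j, l) ∈ w i l`, and
(A2') `w i l ⊆ w i' l'` whenever `T (i, l) ≤ T (i', l')`,
then for every input matrix `X` there is a unique `Y` with `Y = K_E * X + H_E * (α Y)`. -/
theorem sequential_causal_implies_n_uniqueness
    {F : Type*} [Field F] [Fintype F] {m3 m5 m6 n : ℕ}
    (K_E : Matrix (Fin m6) (Fin m3) F) (H_E : Matrix (Fin m6) (Fin m5) F)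
    (α : Matrix (Fin m6) (Fin n) F → Matrix (Fin m5) (Fin n) F)
    (w : Fin m5 → Fin n → Set (Fin m6 × Fin n))
    (hdom : ∀ (i : Fin m5) (l : Fin n) (Y Y' : Matrix (Fin m6) (Fin n) F),
      (∀ p ∈ w i l, Y p.1 p.2 = Y' p.1 p.2) → α Y i l = α Y' i l)
    (T : Fin m5 × Fin n → ℕ) (hT : Function.Injective T)
    (hA1 : ∀ (i : Fin m5) (l : Fin n) (j : Fin m6), (j, l) ∈ w i l → H_E j i = 0)
    (hA2 : ∀ (i : Fin m5) (l : Fin n) (i' : Fin m5) (l' : Fin n),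
      T (i, l) ≤ T (i', l') → w i l ⊆ w i' l') :
    ∀ X : Matrix (Fin m3) (Fin n) F, ∃! Y : Matrix (Fin m6) (Fin n) F,
      Y = K_E * X + H_E * (α Y) := by
  intro X
  set f : Matrix (Fin m6) (Fin n) F → Matrix (Fin m6) (Fin n) F :=
    fun Y => K_E * X + H_E * (α Y) with hf
  have key : ∀ (t : ℕ) (Y Y' : Matrix (Fin m6) (Fin n) F) (i : Fin m5) (l : Fin n),
      T (i, l) < t → α (f^[t] Y) i l = α (f^[t] Y') i l := by
    intro t
    induction t with
    | zero => intro Y Y' i l h; exact absurd h (Nat.not_lt_zero _)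
    | succ t ih =>
      intro Y Y' i l h
      refine hdom i l _ _ fun p hp => ?_
      rw [Function.iterate_succ_apply', Function.iterate_succ_apply']
      simp only [hf, Matrix.add_apply, Matrix.mul_apply]
      congr 1
      refine Finset.sum_congr rfl fun i' _ => ?_
      by_cases hle : T (i, l) ≤ T (i', p.2)
      · rw [hA1 i' p.2 p.1 (hA2 i l i' p.2 hle hp), zero_mul, zero_mul]
      · rw [ih Y Y' i' p.2 (by omega)]
  obtain ⟨N, hN⟩ := (Set.finite_range T).bddAbove
  refine existsUnique_eq_apply_of_iterate_const f (N + 1 + 1) fun Y Y' => ?_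
  have hα : α (f^[N + 1] Y) = α (f^[N + 1] Y') := by
    ext i l
    exact key (N + 1) Y Y' i l (Nat.lt_succ_of_le (hN (Set.mem_range_self (i, l))))
  rw [Function.iterate_succ_apply' f (N + 1) Y, Function.iterate_succ_apply' f (N + 1) Y']
  exact congrArg (fun A => K_E * X + H_E * A) hα
end

section
/- (n-simultaneous transmission: causal condition implies n-uniqueness.) Suppose the strategy α has row components α_i : Matrix (Fin m6) (Fin n) F → (Fin n → F) (so that row i of α Y is α_i Y), admitting domain index subsets w_i ⊆ Fin m6 (i.e., α_i Y = α_i Y' whenever the rows of Y and Y' with index in w_i coincide), and the causal condition holds: (A1) H_E j i = 0 whenever j ∈ w_i, and (A2) w_i ⊆ w_{i'} whenever i ≤ i'. Then α satisfies the n-uniqueness condition: for every X there is a unique Y with Y = K_E * X + H_E * (α Y). -/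
/-- A map on a nonempty type, some iterate of which is constant, has a unique fixed point. -/
theorem existsUnique_eq_of_iterate_const {β : Type*} [Nonempty β] (T : β → β) (N : ℕ)
    (hT : ∀ x y, T^[N] x = T^[N] y) : ∃! y, y = T y := by
  obtain ⟨x⟩ := ‹Nonempty β›
  refine ⟨T^[N] x, ?_, fun y hy => ?_⟩
  · change T^[N] x = T (T^[N] x)
    rw [← Function.iterate_succ_apply' T, Function.iterate_succ_apply]
    exact hT _ _
  · rw [← hT y x]
    exact (Function.iterate_fixed hy.symm N).symm

/-- Under the causal condition, if two observations produce the same first `k` rows of injected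
errors, then the observations at the next transmission produce the same first `k + 1` rows. -/
theorem causal_step_agree {R : Type*} [Semiring R] {m5 m6 n : ℕ}
    (B : Matrix (Fin m6) (Fin n) R) (H : Matrix (Fin m6) (Fin m5) R)
    (α : Matrix (Fin m6) (Fin n) R → Matrix (Fin m5) (Fin n) R)
    (w : Fin m5 → Set (Fin m6))
    (hdom : ∀ (i : Fin m5) (Y Y' : Matrix (Fin m6) (Fin n) R),
      (∀ j ∈ w i, Y j = Y' j) → α Y i = α Y' i)
    (hzero : ∀ i : Fin m5, ∀ j ∈ w i, H j i = 0)
    (hmono : ∀ i i' : Fin m5, i ≤ i' → w i ⊆ w i')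
    {Y Y' : Matrix (Fin m6) (Fin n) R} {k : ℕ}
    (h : ∀ i : Fin m5, i.val < k → α Y i = α Y' i) (i : Fin m5) (hi : i.val < k + 1) :
    α (B + H * α Y) i = α (B + H * α Y') i := by
  refine hdom i _ _ fun j hj => funext fun c => ?_
  simp only [Matrix.add_apply, Matrix.mul_apply]
  congr 1
  refine Finset.sum_congr rfl fun l _ => ?_
  rcases lt_or_ge l i with hl | hl
  · rw [h l (by have : l.val < i.val := hl; omega)]
  · rw [hzero l j (hmono i l hl hj), zero_mul, zero_mul]

/-- **`n`-simultaneous transmission: the causal condition implies the `n`-uniqueness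
condition.** The strategy `α` has row components `αr i` (row `i` of `α Y` is `αr i Y`),
each depending only on the rows of `Y` indexed by the domain index subset `w i ⊆ Fin m6`.
If (A1) `H_E j i = 0` whenever `j ∈ w i`, and (A2) `w i ⊆ w i'` whenever `i ≤ i'`,
then for every input matrix `X` there is a unique `Y` with `Y = K_E * X + H_E * (α Y)`. -/
theorem simultaneous_causal_implies_n_uniqueness
    {F : Type*} [Field F] [Fintype F] {m3 m5 m6 n : ℕ}
    (K_E : Matrix (Fin m6) (Fin m3) F) (H_E : Matrix (Fin m6) (Fin m5) F)
    (α : Matrix (Fin m6) (Fin n) F → Matrix (Fin m5) (Fin n) F)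
    (αr : Fin m5 → Matrix (Fin m6) (Fin n) F → (Fin n → F))
    (hrow : ∀ (i : Fin m5) (Y : Matrix (Fin m6) (Fin n) F), α Y i = αr i Y)
    (w : Fin m5 → Set (Fin m6))
    (hdom : ∀ (i : Fin m5) (Y Y' : Matrix (Fin m6) (Fin n) F),
      (∀ j ∈ w i, Y j = Y' j) → αr i Y = αr i Y')
    (hA1 : ∀ (i : Fin m5), ∀ j ∈ w i, H_E j i = 0)
    (hA2 : ∀ i i' : Fin m5, i ≤ i' → w i ⊆ w i') :
    ∀ X : Matrix (Fin m3) (Fin n) F, ∃! Y : Matrix (Fin m6) (Fin n) F,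
      Y = K_E * X + H_E * (α Y) := by
  intro X
  have hdom' : ∀ (i : Fin m5) (Y Y' : Matrix (Fin m6) (Fin n) F),
      (∀ j ∈ w i, Y j = Y' j) → α Y i = α Y' i := fun i Y Y' h => by
    rw [hrow, hrow, hdom i Y Y' h]
  let T : Matrix (Fin m6) (Fin n) F → Matrix (Fin m6) (Fin n) F :=
    fun Y => K_E * X + H_E * α Y
  have agree : ∀ (k : ℕ) (Y Y' : Matrix (Fin m6) (Fin n) F) (i : Fin m5), i.val < k →
      α (T^[k] Y) i = α (T^[k] Y') i := by
    intro k Y Y'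
    induction k with
    | zero => exact fun i hi => absurd hi (Nat.not_lt_zero _)
    | succ k ih =>
      rw [Function.iterate_succ_apply', Function.iterate_succ_apply']
      exact causal_step_agree (K_E * X) H_E α w hdom' hA1 hA2 ih
  refine existsUnique_eq_of_iterate_const T (m5 + 1) fun Y Y' => ?_
  have hα : α (T^[m5] Y) = α (T^[m5] Y') := funext fun i => agree m5 Y Y' i i.isLt
  rw [Function.iterate_succ_apply', Function.iterate_succ_apply']
  simp only [T] at hα ⊢
  rw [hα]
end

section
/- If θ satisfies the partial time-ordered condition (θ j j' = 0 whenever j' ≥ j), then the product P = M'_{m7} ⋯ M'_1 satisfies that P − I is lower triangular with zero diagonal: the (a, b) entry of P − I is 0 whenever a ≤ b (equivalently, P a b = 0 for a < b and P a a = 1 for all a). -/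
/-- The matrix `M'_j` of the wiretap and addition model: its row with index `m3 + j`
is `[θ_{m3+j, j'} + δ_{m3+j, j'}]_{j'}`, and every other row is the corresponding
row of the identity matrix. (Indices `j : Fin m7` are 0-based.) -/
def Mprime {F : Type*} [Field F] {m3 m7 : ℕ}
    (θ : Matrix (Fin (m3 + m7)) (Fin (m3 + m7)) F) (j : Fin m7) :
    Matrix (Fin (m3 + m7)) (Fin (m3 + m7)) F :=
  Matrix.of fun a b =>
    if a = Fin.natAdd m3 j then θ a b + (if a = b then (1 : F) else 0)
    else (if a = b then (1 : F) else 0)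

/-- The product `P = M'_{m7} ⋯ M'_1`, with the factors in decreasing order of `j`
from left to right. -/
def Pprod {F : Type*} [Field F] {m3 m7 : ℕ}
    (θ : Matrix (Fin (m3 + m7)) (Fin (m3 + m7)) F) :
    Matrix (Fin (m3 + m7)) (Fin (m3 + m7)) F :=
  ((List.finRange m7).reverse.map (Mprime θ)).prod

/-- Lower unitriangular matrices are closed under multiplication. -/
theorem Matrix.mul_apply_eq_one_apply_of_le {n R : Type*} [LinearOrder n] [Fintype n]
    [NonAssocSemiring R] {M N : Matrix n n R}
    (hM : ∀ a b, a ≤ b → M a b = (1 : Matrix n n R) a b)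
    (hN : ∀ a b, a ≤ b → N a b = (1 : Matrix n n R) a b) (a b : n) (hab : a ≤ b) :
    (M * N) a b = (1 : Matrix n n R) a b := by
  rw [← hM a b hab, ← congrFun (congrFun (Matrix.mul_one M) a) b, Matrix.mul_apply,
    Matrix.mul_apply]
  refine Finset.sum_congr rfl fun k _ => ?_
  rcases le_or_gt k b with hk | hk
  · rw [hN k b hk]
  · have hak : a < k := hab.trans_lt hk
    rw [hM a k hak.le, Matrix.one_apply_ne hak.ne, zero_mul, zero_mul]

/-- A product of lower unitriangular matrices is lower unitriangular. -/
theorem Matrix.list_prod_apply_eq_one_apply_of_le {n R : Type*} [LinearOrder n] [Fintype n]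
    [Semiring R] (l : List (Matrix n n R))
    (hl : ∀ M ∈ l, ∀ a b, a ≤ b → M a b = (1 : Matrix n n R) a b) :
    ∀ a b, a ≤ b → l.prod a b = (1 : Matrix n n R) a b := by
  induction l with
  | nil => simp
  | cons M l ih =>
    rw [List.prod_cons]
    exact Matrix.mul_apply_eq_one_apply_of_le (hl M (by simp))
      (ih fun N hN => hl N (by simp [hN]))

theorem Mprime_apply_eq_one_apply_of_le {F : Type*} [Field F] {m3 m7 : ℕ}
    {θ : Matrix (Fin (m3 + m7)) (Fin (m3 + m7)) F}
    (hθ : ∀ j j' : Fin (m3 + m7), j ≤ j' → θ j j' = 0) (j : Fin m7)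
    (a b : Fin (m3 + m7)) (hab : a ≤ b) :
    Mprime θ j a b = (1 : Matrix (Fin (m3 + m7)) (Fin (m3 + m7)) F) a b := by
  simp [Mprime, hθ a b hab, Matrix.one_apply]

/-- If the coefficient matrix `θ` satisfies the partial time-ordered condition
(`θ j j' = 0` whenever `j' ≥ j`), then `P - I` is lower triangular with zero diagonal:
`(P - I) a b = 0` whenever `a ≤ b`; equivalently, `P a b = 0` for `a < b` and
`P a a = 1` for all `a`. -/
theorem Pprod_sub_one_strictly_lower_triangular
    {F : Type*} [Field F] {m3 m7 : ℕ}
    (θ : Matrix (Fin (m3 + m7)) (Fin (m3 + m7)) F)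
    (hθ : ∀ j j' : Fin (m3 + m7), j ≤ j' → θ j j' = 0) :
    (∀ a b : Fin (m3 + m7), a ≤ b → (Pprod θ - 1) a b = 0) ∧
    (∀ a b : Fin (m3 + m7), a < b → Pprod θ a b = 0) ∧
    (∀ a : Fin (m3 + m7), Pprod θ a a = 1) := by
  have h : ∀ a b : Fin (m3 + m7), a ≤ b → Pprod θ a b = (1 : Matrix _ _ F) a b := by
    refine Matrix.list_prod_apply_eq_one_apply_of_le _ fun M hM => ?_
    obtain ⟨j, -, rfl⟩ := List.mem_map.1 hM
    exact Mprime_apply_eq_one_apply_of_le hθ j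
  refine ⟨fun a b hab => ?_, fun a b hab => ?_, fun a => ?_⟩
  · rw [Matrix.sub_apply, h a b hab, sub_self]
  · rw [h a b hab.le, Matrix.one_apply_ne hab.ne]
  · rw [h a a le_rfl, Matrix.one_apply_eq]
end

section
/- (Chain lemma.) Suppose θ satisfies the partial time-ordered condition. Let a, b : Fin m1 with a ≠ b. If there is no finite sequence a = j_1 > j_2 > ⋯ > j_l = b of indices in Fin m1 with θ_{j_t, j_{t+1}} ≠ 0 for every t = 1, …, l−1, then the (a, b) entry of P = M'_{m7} ⋯ M'_1 is 0. -/
/-- If every matrix in a list has its nonzero entries on a reflexive and transitive relation,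
then so does the product of the list. -/
theorem Matrix.list_prod_apply_eq_zero_of_not_rel {n R : Type*} [Fintype n] [DecidableEq n]
    [Semiring R] {r : n → n → Prop} (hrefl : ∀ x, r x x)
    (htrans : ∀ x y z, r x y → r y z → r x z) (L : List (Matrix n n R))
    (hL : ∀ M ∈ L, ∀ x y, ¬ r x y → M x y = 0) (x y : n) (hxy : ¬ r x y) :
    L.prod x y = 0 := by
  induction L generalizing x y with
  | nil =>
    rw [List.prod_nil, Matrix.one_apply_ne]
    rintro rfl
    exact hxy (hrefl x)
  | cons M L ih =>
    rw [List.prod_cons, Matrix.mul_apply]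
    refine Finset.sum_eq_zero fun z _ => ?_
    by_cases hxz : r x z
    · rw [ih (fun N hN => hL N (List.mem_cons_of_mem M hN)) z y
        fun hzy => hxy (htrans x z y hxz hzy), mul_zero]
    · rw [hL M List.mem_cons_self x z hxz, zero_mul]

/-- **Chain lemma.** Suppose `θ` satisfies the partial time-ordered condition and
`a ≠ b`. If there is no finite sequence `a = j₁ > j₂ > ⋯ > j_l = b` with
`θ (j_t) (j_{t+1}) ≠ 0` for each `t` (i.e., no chain of nonzero entries of `θ` leading
from `a` down to `b`, expressed via the transitive closure of the one-step relation),
then the `(a, b)` entry of `P = M'_{m7} ⋯ M'_1` is `0`. -/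
theorem Pprod_entry_eq_zero_of_no_chain
    {F : Type*} [Field F] {m3 m7 : ℕ}
    (θ : Matrix (Fin (m3 + m7)) (Fin (m3 + m7)) F)
    (hθ : ∀ j j' : Fin (m3 + m7), j ≤ j' → θ j j' = 0)
    (a b : Fin (m3 + m7)) (hab : a ≠ b)
    (hchain : ¬ Relation.TransGen
      (fun x y : Fin (m3 + m7) => y < x ∧ θ x y ≠ 0) a b) :
    Pprod θ a b = 0 := by
  refine Matrix.list_prod_apply_eq_zero_of_not_rel
    (r := Relation.ReflTransGen fun x y : Fin (m3 + m7) => y < x ∧ θ x y ≠ 0)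
    (fun _ => .refl) (fun _ _ _ => .trans) _ ?_ a b ?_
  · intro M hM x y hxy
    obtain ⟨j, -, rfl⟩ := List.mem_map.1 hM
    have hne : x ≠ y := by
      rintro rfl
      exact hxy .refl
    have hzero : θ x y = 0 := by
      by_contra h
      exact hxy (.single ⟨lt_of_not_ge fun hle => h (hθ x y hle), h⟩)
    simp [Mprime, hne, hzero]
  · rw [Relation.reflTransGen_iff_eq_or_transGen]
    exact fun h => h.elim (fun h => hab h.symm) hchain
end

section
/- (Admissibility implies condition (A1) of the causal condition.) Suppose θ satisfies the partial time-ordered condition. Define γ_θ : Fin m1 → ℕ by γ_θ(j) = min { j' : ℕ | j' < m1 and θ_{j', j} ≠ 0 } if such j' exists, and γ_θ(j) = m1 + 1 otherwise (identifying elements of Fin m1 with natural numbers). Let ζ_E : Fin m6 → Fin m1 be strictly increasing, η : Fin m5 → Fin m1 injective, and w_i ⊆ Fin m6 subsets such that every j ∈ w_i satisfies ζ_E(j) < γ_θ(η(i)). Define H_E : Matrix (Fin m6) (Fin m5) F by H_E j i = (P − I)_{ζ_E(j), η(i)}. Then H_E j i = 0 for every i and every j ∈ w_i. -/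
open scoped Classical

/-- `γ_θ(j)`: the minimum natural number `j' < m1` with `θ j' j ≠ 0` if such `j'`
exists, and `m1 + 1` otherwise (identifying elements of `Fin m1` with naturals). -/
noncomputable def gammaTheta {F : Type*} [Field F] {m1 : ℕ}
    (θ : Matrix (Fin m1) (Fin m1) F) (j : Fin m1) : ℕ :=
  if ∃ k : ℕ, ∃ hk : k < m1, θ ⟨k, hk⟩ j ≠ 0 then
    sInf {k : ℕ | ∃ hk : k < m1, θ ⟨k, hk⟩ j ≠ 0}
  else m1 + 1

theorem Mprime_mul_apply {F : Type*} [Field F] {m3 m7 : ℕ}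
    (θ Q : Matrix (Fin (m3 + m7)) (Fin (m3 + m7)) F) (j : Fin m7) (a b : Fin (m3 + m7)) :
    (Mprime θ j * Q) a b =
      if a = Fin.natAdd m3 j then ∑ c, θ a c * Q c b + Q a b else Q a b := by
  split_ifs with h <;>
    simp [Matrix.mul_apply, Mprime, h, add_mul, ite_mul, Finset.sum_add_distrib]

/-- A product of matrices `M'_j`, in any order, agrees with the identity matrix in column `b`
above the first nonzero entry of that column of `θ`. -/
theorem prod_map_Mprime_apply_eq_one {F : Type*} [Field F] {m3 m7 : ℕ}
    {θ : Matrix (Fin (m3 + m7)) (Fin (m3 + m7)) F}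
    (hθ : ∀ j j' : Fin (m3 + m7), j ≤ j' → θ j j' = 0) {b : Fin (m3 + m7)} {N : ℕ}
    (hN : ∀ k : Fin (m3 + m7), (k : ℕ) < N → θ k b = 0) (l : List (Fin m7))
    (a : Fin (m3 + m7)) (ha : (a : ℕ) < N) :
    (l.map (Mprime θ)).prod a b = (1 : Matrix (Fin (m3 + m7)) (Fin (m3 + m7)) F) a b := by
  induction l generalizing a with
  | nil => simp
  | cons j l ih =>
    rw [List.map_cons, List.prod_cons, Mprime_mul_apply]
    split_ifs
    · rw [ih a ha, add_eq_right]
      refine Finset.sum_eq_zero fun c _ => ?_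
      rcases le_or_gt a c with hac | hca
      · rw [hθ a c hac, zero_mul]
      · rw [ih c (lt_trans hca ha), Matrix.one_apply]
        split_ifs with hcb
        · rw [hcb, hN a ha, zero_mul]
        · exact mul_zero _
    · exact ih a ha

theorem eq_zero_of_lt_gammaTheta {F : Type*} [Field F] {m1 : ℕ}
    {θ : Matrix (Fin m1) (Fin m1) F} {k j : Fin m1} (hk : (k : ℕ) < gammaTheta θ j) :
    θ k j = 0 := by
  by_contra h
  rw [gammaTheta, if_pos ⟨k, k.isLt, h⟩] at hk
  exact Nat.notMem_of_lt_sInf hk ⟨k.isLt, h⟩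

/-- **Admissibility implies condition (A1) of the causal condition.**
Suppose `θ` satisfies the partial time-ordered condition, `ζ_E` is strictly increasing,
`η` is injective, every `j ∈ w i` satisfies `ζ_E j < γ_θ (η i)` (the admissibility
condition), and `H_E j i = (P - I) (ζ_E j) (η i)`. Then `H_E j i = 0` for all `i` and
all `j ∈ w i`. -/
theorem admissible_implies_A1
    {F : Type*} [Field F] {m3 m7 m5 m6 : ℕ}
    (θ : Matrix (Fin (m3 + m7)) (Fin (m3 + m7)) F)
    (hθ : ∀ j j' : Fin (m3 + m7), j ≤ j' → θ j j' = 0)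
    (ζE : Fin m6 → Fin (m3 + m7)) (hζE : StrictMono ζE)
    (η : Fin m5 → Fin (m3 + m7)) (hη : Function.Injective η)
    (w : Fin m5 → Set (Fin m6))
    (hw : ∀ i : Fin m5, ∀ j ∈ w i, ((ζE j : ℕ) < gammaTheta θ (η i)))
    (H_E : Matrix (Fin m6) (Fin m5) F)
    (hH : ∀ (j : Fin m6) (i : Fin m5), H_E j i = (Pprod θ - 1) (ζE j) (η i)) :
    ∀ i : Fin m5, ∀ j ∈ w i, H_E j i = 0 := by
  intro i j hj
  rw [hH, Matrix.sub_apply, sub_eq_zero, Pprod]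
  exact prod_map_Mprime_apply_eq_one hθ (fun _ => eq_zero_of_lt_gammaTheta) _ _ (hw i j hj)
end

section
/- Let F be a field and κ ∈ F an element satisfying κ² = κ + 1. Define the following subsets of Fin 3 → F: S₁ = {(1,0,0)}; S₂ = {(κ, 1+κ, κ), (1,0,0), (1+κ, 1+κ, κ)}; S₃ = {(0,1,1), (1,0,0), (1,1,1)}; S₄ = {(0,1,0), (1,0,0), (1,1,0)}. Then for each i ∈ {1,2,3,4}, the vector (0,0,1) does not belong to the F-linear span of S_i. -/
/-- A vector with nonzero dot product against some `w` orthogonal to `S` is not in the span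
of `S`. -/
theorem notMem_span_of_dotProduct {R n : Type*} [CommRing R] [Fintype n] {S : Set (n → R)}
    {v : n → R} (w : n → R) (hS : ∀ s ∈ S, w ⬝ᵥ s = 0) (hv : w ⬝ᵥ v ≠ 0) :
    v ∉ Submodule.span R S := by
  intro h
  have hle : Submodule.span R S ≤ LinearMap.ker (dotProductBilin R R w) :=
    Submodule.span_le.2 hS
  exact hv (hle h)

/-- Secrecy of the message in the two-transmission network example. With `κ² = κ + 1`,
the message vector `(0,0,1)` (in the basis `(L1, L2, M)`) lies outside the linear span
of each of the four sets `S₁, S₂, S₃, S₄` of vectors describing Eve's eavesdropped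
information when she attacks node `v(1)`, `v(2)`, `v(3)`, `v(4)` respectively. -/
theorem message_secrecy_four_nodes
    {F : Type*} [Field F] (κ : F) (hκ : κ ^ 2 = κ + 1) :
    (![0, 0, 1] : Fin 3 → F) ∉
      Submodule.span F ({![1, 0, 0]} : Set (Fin 3 → F)) ∧
    (![0, 0, 1] : Fin 3 → F) ∉
      Submodule.span F ({![κ, 1 + κ, κ], ![1, 0, 0], ![1 + κ, 1 + κ, κ]} :
        Set (Fin 3 → F)) ∧
    (![0, 0, 1] : Fin 3 → F) ∉
      Submodule.span F ({![0, 1, 1], ![1, 0, 0], ![1, 1, 1]} : Set (Fin 3 → F)) ∧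
    (![0, 0, 1] : Fin 3 → F) ∉
      Submodule.span F ({![0, 1, 0], ![1, 0, 0], ![1, 1, 0]} : Set (Fin 3 → F)) := by
  have hκ1 : 1 + κ ≠ 0 := by
    intro h
    have h0 : κ = 0 := by
      rw [add_comm κ 1, h] at hκ
      exact pow_eq_zero_iff two_ne_zero |>.1 hκ
    simp [h0] at h
  refine ⟨notMem_span_of_dotProduct ![0, 0, 1] ?_ ?_,
    notMem_span_of_dotProduct ![0, -κ, 1 + κ] ?_ ?_,
    notMem_span_of_dotProduct ![0, -1, 1] ?_ ?_,
    notMem_span_of_dotProduct ![0, 0, 1] ?_ ?_⟩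
  all_goals simp [dotProduct, Fin.sum_univ_three, hκ1]
  ring
end

section
/- Let F be a field and κ ∈ F an element satisfying κ² = κ + 1. Define the upper-layer set U = {(1,0,0), (κ, 1+κ, κ), (0,1,1), (0,1,0)} and the lower-layer set L = {(1+κ, 1+κ, κ), (1,1,1), (1,1,0)}, both subsets of Fin 3 → F. Then for every u ∈ U and every v ∈ L, the vector (0,0,1) does not belong to the F-linear span of {u, v}. -/
/-- If `u` has distinct first two coordinates and `v` has equal nonzero ones, then no nonzero
combination of `u` and `v` vanishes in both, so `(0,0,1)` is not in their span. -/
theorem not_mem_span_pair_of_ne_of_eq {F : Type*} [Field F] {u v : Fin 3 → F}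
    (hu : u 0 ≠ u 1) (hv : v 0 = v 1) (hv0 : v 0 ≠ 0) :
    (![0, 0, 1] : Fin 3 → F) ∉ Submodule.span F ({u, v} : Set (Fin 3 → F)) := by
  rw [Submodule.mem_span_pair]
  rintro ⟨a, b, h⟩
  have h0 : a * u 0 + b * v 0 = 0 := by simpa using congrFun h 0
  have h1 : a * u 1 + b * v 1 = 0 := by simpa using congrFun h 1
  have h2 : a * u 2 + b * v 2 = 1 := by simpa using congrFun h 2
  have ha : a = 0 := by
    have hmul : a * (u 0 - u 1) = 0 := by linear_combination h0 - h1 - b * hv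
    exact (mul_eq_zero.mp hmul).resolve_right (sub_ne_zero.mpr hu)
  have hb : b = 0 := by
    rw [ha, zero_mul, zero_add] at h0
    exact (mul_eq_zero.mp h0).resolve_right hv0
  simp [ha, hb] at h2

/-- Secrecy of the message in the two-transmission network example against a two-layer
attack. With `κ² = κ + 1`, for every upper-layer vector `u ∈ U` and lower-layer vector
`v ∈ L`, the message vector `(0,0,1)` (in the basis `(L1, L2, M)`) lies outside the
`F`-linear span of `{u, v}`. -/
theorem message_secrecy_two_layers
    {F : Type*} [Field F] (κ : F) (hκ : κ ^ 2 = κ + 1) :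
    ∀ u ∈ ({![1, 0, 0], ![κ, 1 + κ, κ], ![0, 1, 1], ![0, 1, 0]} : Set (Fin 3 → F)),
    ∀ v ∈ ({![1 + κ, 1 + κ, κ], ![1, 1, 1], ![1, 1, 0]} : Set (Fin 3 → F)),
      (![0, 0, 1] : Fin 3 → F) ∉ Submodule.span F ({u, v} : Set (Fin 3 → F)) := by
  have hκ0 : 1 + κ ≠ 0 := by
    intro h
    have hsq : κ ^ 2 = 0 := by linear_combination hκ + h
    have hzero : κ = 0 := pow_eq_zero_iff two_ne_zero |>.mp hsq
    simp [hzero] at h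
  intro u hu v hv
  have hu' : u 0 ≠ u 1 := by
    rcases hu with rfl | rfl | rfl | rfl <;> simp
  have hv' : v 0 = v 1 ∧ v 0 ≠ 0 := by
    rcases hv with rfl | rfl | rfl <;> simp [hκ0]
  exact not_mem_span_pair_of_ne_of_eq hu' hv'.1 hv'.2
end
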